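/- For every NPLCS N and every set of locations A ⊆ Q, there exists a memoryless scheduler U such that for all x ∈ Prom(A) and all channel contents w, Pr_U((x,w) ⊨ ◇A) = 1, i.e., almost surely the path eventually visits a location of A. -/

import Mathlib

open scoped ENNReal
open Classical

namespace NPLCSmodel

/-! ## Lossy channel systems -/

/-- Operations of a lossy channel system: send a message on a channel,
receive a message from a channel, or an internal action. -/
inductive LcsOp (C M : Type) : Type where
  | send : C → M → LcsOp C M
  | recv : C → M → LcsOp C M
  | internal : LcsOp C M

def LcsOp.IsRecv {C M : Type} : LcsOp C M → Prop
  | .recv _ _ => True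
  | _ => False

/-- A transition rule `src --op--> dst`. -/
structure LcsRule (Q C M : Type) : Type where
  src : Q
  op : LcsOp C M
  dst : Q

/-- Channel contents: a word over `M` for each channel. -/
abbrev Chans (C M : Type) : Type := C → List M

/-- Configurations: a location together with channel contents. -/
abbrev Conf (Q C M : Type) : Type := Q × Chans C M

/-- The empty channel contents ε. -/
def eps (C M : Type) : Chans C M := fun _ => []

variable {Q C M : Type}

/-- When is an operation possible on channel contents `w`? -/
def enabledOp : LcsOp C M → Chans C M → Prop
  | .recv c m, w => ∃ v, w c = m :: v
  | .send _ _, _ => True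
  | .internal, _ => True

/-- Effect of an operation on the channel contents (for a perfect step). -/
def applyOp [DecidableEq C] : LcsOp C M → Chans C M → Chans C M
  | .send c m, w => Function.update w c (w c ++ [m])
  | .recv c _, w => Function.update w c (w c).tail
  | .internal, w => w

/-- A rule is enabled in a configuration. -/
def LcsRule.EnabledIn (δ : LcsRule Q C M) (s : Conf Q C M) : Prop :=
  δ.src = s.1 ∧ enabledOp δ.op s.2

/-- A lossy channel system `L = (Q, C, M, Δ)` (the finiteness of the location,
channel and message types is imposed by `Fintype` assumptions at use sites):
a finite set of transition rules such that every location has at least one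
outgoing rule that is not a receive. -/
structure LCS (Q C M : Type) : Type where
  rules : Set (LcsRule Q C M)
  finiteRules : rules.Finite
  noDeadlock : ∀ q : Q, ∃ δ ∈ rules, δ.src = q ∧ ¬ δ.op.IsRecv

variable [DecidableEq C]

/-- Lossy step via rule `δ`: a perfect step followed by losing arbitrarily
many messages (`<+` is the (componentwise) subword relation). -/
def LCS.StepVia (L : LCS Q C M) (s : Conf Q C M) (δ : LcsRule Q C M)
    (t : Conf Q C M) : Prop :=
  δ ∈ L.rules ∧ δ.EnabledIn s ∧ t.1 = δ.dst ∧ ∀ c, List.Sublist (t.2 c) (applyOp δ.op s.2 c)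

/-- Lossy step `s → t`. -/
def LCS.Step (L : LCS Q C M) (s t : Conf Q C M) : Prop := ∃ δ, L.StepVia s δ t

/-- Reachability `s →* t`. -/
def LCS.Reach (L : LCS Q C M) : Conf Q C M → Conf Q C M → Prop :=
  Relation.ReflTransGen L.Step

/-- Constrained reachability `s →*_[X) t`: all configurations along the path,
except possibly the last one, have their location in `X`. -/
def LCS.ReachWithin (L : LCS Q C M) (X : Set Q) : Conf Q C M → Conf Q C M → Prop :=
  Relation.ReflTransGen (fun a b => L.Step a b ∧ a.1 ∈ X)

/-- Constrained reachability `s →*_[X] t`: all configurations along the path,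
including `s` and `t`, have their location in `X`. -/
def LCS.ReachConstrained (L : LCS Q C M) (X : Set Q) (s t : Conf Q C M) : Prop :=
  L.ReachWithin X s t ∧ t.1 ∈ X

/-- `X` is safe for `A`. -/
def LCS.IsSafeFor (L : LCS Q C M) (A X : Set Q) : Prop :=
  X ⊆ A ∧ ∀ x ∈ X, ∃ t, L.Step (x, eps C M) t ∧ t.1 ∈ X

/-- `Safe(A)`: the largest set safe for `A` (the union of all such sets). -/
def LCS.Safe (L : LCS Q C M) (A : Set Q) : Set Q := ⋃₀ {X | L.IsSafeFor A X}

/-- `X` is promising for `A`. -/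
def LCS.IsPromisingFor (L : LCS Q C M) (A X : Set Q) : Prop :=
  ∀ x ∈ X, ∃ t, L.ReachWithin X (x, eps C M) t ∧ t.1 ∈ A

/-- `Prom(A)`: the largest set promising for `A` (the union of all such sets). -/
def LCS.Prom (L : LCS Q C M) (A : Set Q) : Set Q := ⋃₀ {X | L.IsPromisingFor A X}

/-! ## NPLCS and the induced Markov decision process -/

/-- An NPLCS: an LCS together with a fault rate `τ ∈ (0,1)`. -/
structure NPLCS (Q C M : Type) : Type where
  L : LCS Q C M
  τ : ℝ
  τ_pos : 0 < τ
  τ_lt_one : τ < 1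

/-- The number of embeddings of the second list as a subword of the first. -/
def countEmb [DecidableEq M] : List M → List M → ℕ
  | _, [] => 1
  | [], _ :: _ => 0
  | a :: v, b :: w => (if a = b then countEmb v w else 0) + countEmb v (b :: w)

variable [Fintype C] [DecidableEq M]

/-- Total number of messages in the channels. -/
def chansSize (w : Chans C M) : ℕ := ∑ c, (w c).length

/-- `P_lost(v,v') = τ^(|v|-|v'|) · (1-τ)^|v'| · C(v,v')`, the probability that
channel contents `v` become `v'` through message losses. -/
noncomputable def plost (τ : ℝ) (v v' : Chans C M) : ℝ≥0∞ :=
  ENNReal.ofReal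
    (τ ^ (chansSize v - chansSize v') * (1 - τ) ^ chansSize v' *
      (∏ c, countEmb (v c) (v' c) : ℕ))

/-- One-step probability `P_N(s, δ, t)` of the MDP of an NPLCS. -/
noncomputable def NPLCS.stepProb (N : NPLCS Q C M) (s : Conf Q C M)
    (δ : LcsRule Q C M) (t : Conf Q C M) : ℝ≥0∞ :=
  if δ ∈ N.L.rules ∧ δ.EnabledIn s ∧ t.1 = δ.dst then
    plost N.τ (applyOp δ.op s.2) t.2
  else 0

/-! ## Probability measure of a countable-state Markov chain

Given one-step probabilities `k` on a state space `S`, the measure of a set of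
trajectories is the Carathéodory outer measure generated by the probabilities
of cylinder sets; it agrees with the usual Markov-chain measure on all
measurable (in particular, on all ω-regular) sets of trajectories. -/

section Chain
variable {S : Type}

/-- Probability that the chain starting in `s` performs the finite sequence
of steps through the configurations listed in `l`. -/
noncomputable def chainPathProb (k : S → S → ℝ≥0∞) : S → List S → ℝ≥0∞
  | _, [] => 1
  | s, t :: l => k s t * chainPathProb k t l

/-- The cylinder of trajectories starting with `s` followed by `l`. -/
def chainCyl (s : S) (l : List S) : Set (ℕ → S) :=
  {ω | ω 0 = s ∧ ∀ (i : ℕ) (h : i < l.length), ω (i + 1) = l.get ⟨i, h⟩}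

/-- Premeasure: probability of a cylinder set, `∞` on other (nonempty) sets. -/
noncomputable def chainFun (k : S → S → ℝ≥0∞) (s : S) (A : Set (ℕ → S)) : ℝ≥0∞ :=
  if A = ∅ then 0 else ⨅ (l : List S) (_ : A = chainCyl s l), chainPathProb k s l

theorem chainFun_empty (k : S → S → ℝ≥0∞) (s : S) : chainFun k s ∅ = 0 := by
  simp [chainFun]

/-- The probability, for the Markov chain with one-step probabilities `k`
started in `s`, of the set `E` of trajectories (paths starting in `s`). -/
noncomputable def chainPr (k : S → S → ℝ≥0∞) (s : S) (E : Set (ℕ → S)) : ℝ≥0∞ :=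
  MeasureTheory.OuterMeasure.ofFunction (chainFun k s) (chainFun_empty k s)
    (E ∩ {ω | ω 0 = s})

end Chain

/-! ## Schedulers -/

/-- A (history-dependent, deterministic) scheduler: given the history
`h = s₁ → ⋯ → s_{n-1}` and the current configuration `sₙ`, it chooses a
transition rule of `N` enabled in `sₙ`. -/
structure Scheduler (N : NPLCS Q C M) : Type where
  choose : List (Conf Q C M) → Conf Q C M → LcsRule Q C M
  choose_mem : ∀ h s, choose h s ∈ N.L.rules
  choose_enabled : ∀ h s, (choose h s).EnabledIn s

variable {N : NPLCS Q C M}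

/-- The Markov chain `MC_U` induced by a scheduler: its states are finite
paths, represented as (history, current configuration). -/
noncomputable def Scheduler.kernel (U : Scheduler N) :
    List (Conf Q C M) × Conf Q C M → List (Conf Q C M) × Conf Q C M → ℝ≥0∞ :=
  fun a b =>
    if b.1 = a.1 ++ [a.2] then N.stepProb a.2 (U.choose a.1 a.2) b.2 else 0

/-- `Pr_U(s ⊨ E)`: the probability, under scheduler `U` with starting
configuration `s`, of the set `E` of infinite paths (trajectories of
configurations). -/
noncomputable def Scheduler.Pr (U : Scheduler N) (s : Conf Q C M)
    (E : Set (ℕ → Conf Q C M)) : ℝ≥0∞ :=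
  chainPr U.kernel ([], s) {ω | (fun i => (ω i).2) ∈ E}

/-- Memoryless scheduler: the decision depends only on the current
configuration. -/
def Scheduler.Memoryless (U : Scheduler N) : Prop :=
  ∀ h h' s, U.choose h s = U.choose h' s

/-- Blind scheduler: the decision depends only on the sequence of locations
that have been visited. -/
def Scheduler.Blind (U : Scheduler N) : Prop :=
  ∀ h h' s s', h.map Prod.fst = h'.map Prod.fst → s.1 = s'.1 →
    U.choose h s = U.choose h' s'

/-- Finite-memory scheduler data: finitely many modes, a starting mode, a
decision rule and a next-mode function. -/
structure FMScheduler (N : NPLCS Q C M) : Type 1 where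
  Mode : Type
  modeFin : Fintype Mode
  init : Mode
  D : Mode → Conf Q C M → LcsRule Q C M
  upd : Mode → Conf Q C M → Mode
  D_mem : ∀ u s, D u s ∈ N.L.rules
  D_enabled : ∀ u s, (D u s).EnabledIn s

/-- A scheduler is finite-memory if it is induced by finite-memory data. -/
def Scheduler.FiniteMemory (U : Scheduler N) : Prop :=
  ∃ fm : FMScheduler N, ∀ h s, U.choose h s = fm.D (h.foldl fm.upd fm.init) s

/-- The Markov chain `MC_U` of a finite-memory scheduler: states are pairs
`s_u` of a configuration `s` and a mode `u`. -/
noncomputable def FMScheduler.kernel (fm : FMScheduler N) :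
    Conf Q C M × fm.Mode → Conf Q C M × fm.Mode → ℝ≥0∞ :=
  fun a b =>
    if b.2 = fm.upd a.2 a.1 then N.stepProb a.1 (fm.D a.2 a.1) b.1 else 0

/-- Probability measure of the Markov chain `MC_U` of a finite-memory
scheduler, over trajectories of (configuration, mode) states. -/
noncomputable def FMScheduler.PrMC (fm : FMScheduler N)
    (a : Conf Q C M × fm.Mode) (E : Set (ℕ → Conf Q C M × fm.Mode)) : ℝ≥0∞ :=
  chainPr fm.kernel a E

/-- Reachability in the Markov chain `MC_U` of a finite-memory scheduler. -/
def FMScheduler.MCReach (fm : FMScheduler N) :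
    Conf Q C M × fm.Mode → Conf Q C M × fm.Mode → Prop :=
  Relation.ReflTransGen (fun a b => 0 < fm.kernel a b)

/-- The history (the first `i` configurations) of a trajectory. -/
def histTo (ω : ℕ → Conf Q C M) (i : ℕ) : List (Conf Q C M) :=
  (List.range i).map ω

/-- Almost blind scheduler: there are a scheduler `W` and a blind scheduler
`V` such that from any starting configuration, almost surely the choices of
`U` along the path agree with those of `W` up to some finite time and with
those of `V` afterwards. -/
def Scheduler.AlmostBlind (U : Scheduler N) : Prop :=
  ∃ W V : Scheduler N, V.Blind ∧ ∀ s : Conf Q C M,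
    U.Pr s {ω | ∃ n : ℕ,
      (∀ i ≤ n, U.choose (histTo ω i) (ω i) = W.choose (histTo ω i) (ω i)) ∧
      (∀ i, n < i → U.choose (histTo ω i) (ω i) = V.choose (histTo ω i) (ω i))} = 1

/-! ## LTL-style events on trajectories -/

/-- `□P` -/
def evAlways {α : Type} (P : α → Prop) : Set (ℕ → α) := {ω | ∀ i, P (ω i)}

/-- `◇P` -/
def evEventually {α : Type} (P : α → Prop) : Set (ℕ → α) := {ω | ∃ i, P (ω i)}

/-- `□◇P` -/
def evInfOften {α : Type} (P : α → Prop) : Set (ℕ → α) :=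
  {ω | ∀ n, ∃ i, n ≤ i ∧ P (ω i)}

/-- `◇□P` -/
def evEvAlways {α : Type} (P : α → Prop) : Set (ℕ → α) :=
  {ω | ∃ n, ∀ i, n ≤ i → P (ω i)}

/-- The atomic proposition "the current location belongs to `A`". -/
def inLoc (A : Set Q) : Conf Q C M → Prop := fun s => s.1 ∈ A


/-! ## Avoidance probabilities of a countable Markov chain -/

section ChainAvoidance

open MeasureTheory

variable {S : Type}

/-- Probability that the first `n` states of the chain started in `s` all lie in `D`. -/
noncomputable def avoidProb (k : S → S → ℝ≥0∞) (D : Set S) : ℕ → S → ℝ≥0∞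
  | 0, _ => 1
  | n + 1, s => if s ∈ D then ∑' t, k s t * avoidProb k D n t else 0

/-- The trajectory from `s` whose `n`-th step out of state `x` leads to `ξ (n, x)`. -/
def drivenPath (ξ : ℕ × S → S) (s : S) : ℕ → S
  | 0 => s
  | n + 1 => ξ (n, drivenPath ξ s n)

theorem chainPathProb_eq_prod (k : S → S → ℝ≥0∞) (d : S) (l : List S) (s : S) :
    chainPathProb k s l =
      ∏ i ∈ Finset.range l.length, k ((s :: l).getD i d) ((s :: l).getD (i + 1) d) := by
  induction l generalizing s with
  | nil => simp [chainPathProb]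
  | cons t l ih =>
    rw [List.length_cons, Finset.prod_range_succ', chainPathProb, ih t, mul_comm]
    simp

theorem chainPathProb_append (k : S → S → ℝ≥0∞) (l : List S) (s t : S) :
    chainPathProb k s (l ++ [t]) = chainPathProb k s l * k ((s :: l).getLast (by simp)) t := by
  induction l generalizing s with
  | nil => simp [chainPathProb]
  | cons a l ih => simp [chainPathProb, ih, mul_assoc]

theorem mem_chainCyl_append {s : S} {l : List S} {ω : ℕ → S} (h : ω ∈ chainCyl s l) :
    ω ∈ chainCyl s (l ++ [ω (l.length + 1)]) := by
  refine ⟨h.1, fun i hi => ?_⟩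
  simp only [List.length_append, List.length_singleton] at hi
  rcases Nat.lt_succ_iff_lt_or_eq.1 hi with h' | rfl
  · rw [h.2 i h']
    simp [List.getElem_append_left h']
  · simp

theorem eq_getLast_of_mem_chainCyl {s : S} {l : List S} {ω : ℕ → S} (h : ω ∈ chainCyl s l) :
    ω l.length = (s :: l).getLast (by simp) := by
  rcases List.eq_nil_or_concat l with rfl | ⟨l, t, rfl⟩
  · simpa using h.1
  · have := h.2 l.length (by simp)
    simpa using this

section Driven

variable [MeasurableSpace S] [MeasurableSingletonClass S]

theorem infinitePi_drivenPath_mem_chainCyl_le (p : S → PMF S) (s : S) (l : List S) :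
    Measure.infinitePi (fun i : ℕ × S => (p i.2).toMeasure) {ξ | drivenPath ξ s ∈ chainCyl s l} ≤
      chainPathProb (fun a b => p a b) s l := by
  have hsub : {ξ : ℕ × S → S | drivenPath ξ s ∈ chainCyl s l} ⊆
      Set.pi ↑((Finset.range l.length).image fun i => (i, (s :: l).getD i s))
        (fun q => {(s :: l).getD (q.1 + 1) s}) := by
    intro ξ hξ
    have hst : ∀ i ≤ l.length, drivenPath ξ s i = (s :: l).getD i s := by
      rintro (_ | i) hi
      · simp [drivenPath]
      · have := hξ.2 i hi
        rw [this]
        simp [List.getElem?_eq_getElem (show i < l.length from hi)]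
    rintro ⟨j, x⟩ hq
    simp only [Finset.coe_image, Set.mem_image, Finset.coe_range, Set.mem_Iio, Prod.mk.injEq] at hq
    obtain ⟨i, hi, rfl, rfl⟩ := hq
    rw [Set.mem_singleton_iff, ← hst (i + 1) hi, ← hst i hi.le]
    rfl
  refine (measure_mono hsub).trans ?_
  rw [Measure.infinitePi_pi _ (fun _ _ => measurableSet_singleton _),
    Finset.prod_image (fun a _ b _ h => (Prod.mk.inj h).1),
    chainPathProb_eq_prod _ s]
  refine le_of_eq (Finset.prod_congr rfl fun i _ => ?_)
  exact PMF.toMeasure_apply_singleton _ _ (measurableSet_singleton _)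

theorem infinitePi_drivenPath_avoid_le [Countable S] (p : S → PMF S) (D : Set S) (s : S) (n : ℕ)
    (l : List S) :
    Measure.infinitePi (fun i : ℕ × S => (p i.2).toMeasure)
        {ξ | drivenPath ξ s ∈ chainCyl s l ∧ ∀ i, drivenPath ξ s i ∈ D} ≤
      chainPathProb (fun a b => p a b) s l *
        avoidProb (fun a b => p a b) D n ((s :: l).getLast (by simp)) := by
  induction n generalizing l with
  | zero =>
    rw [avoidProb, mul_one]
    exact (measure_mono fun ξ hξ => hξ.1).trans (infinitePi_drivenPath_mem_chainCyl_le p s l)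
  | succ n ih =>
    rw [avoidProb]
    split_ifs with hD
    · have hsub : {ξ : ℕ × S → S | drivenPath ξ s ∈ chainCyl s l ∧ ∀ i, drivenPath ξ s i ∈ D} ⊆
          ⋃ t, {ξ | drivenPath ξ s ∈ chainCyl s (l ++ [t]) ∧ ∀ i, drivenPath ξ s i ∈ D} :=
        fun ξ hξ => Set.mem_iUnion.2 ⟨_, mem_chainCyl_append hξ.1, hξ.2⟩
      refine (measure_mono hsub).trans ((measure_iUnion_le _).trans ?_)
      rw [← ENNReal.tsum_mul_left]
      refine ENNReal.tsum_le_tsum fun t => (ih (l ++ [t])).trans (le_of_eq ?_)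
      rw [chainPathProb_append, mul_assoc]
      simp
    · have : {ξ : ℕ × S → S | drivenPath ξ s ∈ chainCyl s l ∧ ∀ i, drivenPath ξ s i ∈ D} = ∅ :=
        Set.eq_empty_of_forall_notMem fun ξ hξ =>
          hD (eq_getLast_of_mem_chainCyl hξ.1 ▸ hξ.2 l.length)
      simp [this]

end Driven

theorem chainPr_le_one (k : S → S → ℝ≥0∞) (s : S) (E : Set (ℕ → S)) : chainPr k s E ≤ 1 := by
  refine (measure_mono Set.inter_subset_right).trans
    ((OuterMeasure.ofFunction_le _).trans ?_)
  have hne : ({ω | ω 0 = s} : Set (ℕ → S)) ≠ ∅ :=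
    Set.Nonempty.ne_empty ⟨fun _ => s, rfl⟩
  rw [chainFun, if_neg hne]
  exact iInf₂_le_of_le [] (by ext; simp [chainCyl]) (by simp [chainPathProb])

theorem chainPr_eq_one_of_iInf_avoidProb [Countable S] {k : S → S → ℝ≥0∞}
    (hk : ∀ s, ∑' t, k s t = 1) {D : Set S} {s : S} (h : ⨅ n, avoidProb k D n s = 0) :
    chainPr k s {ω | ∃ i, ω i ∉ D} = 1 := by
  refine le_antisymm (chainPr_le_one _ _ _) ?_
  let _ : MeasurableSpace S := ⊤
  let p : S → PMF S := fun s => ⟨k s, hk s ▸ ENNReal.summable.hasSum⟩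
  let ν := Measure.infinitePi (fun i : ℕ × S => (p i.2).toMeasure)
  let m : OuterMeasure (ℕ → S) := OuterMeasure.map (fun ξ => drivenPath ξ s) ν.toOuterMeasure
  have hm : m ≤ OuterMeasure.ofFunction (chainFun k s) (chainFun_empty k s) := by
    refine OuterMeasure.le_ofFunction.2 fun A => ?_
    rw [chainFun]
    split_ifs with hA
    · simp [hA]
    · refine le_iInf₂ fun l hl => ?_
      subst hl
      exact infinitePi_drivenPath_mem_chainCyl_le p s l
  refine le_trans ?_ (hm _)
  have hzero : ν {ξ | ∀ i, drivenPath ξ s i ∈ D} = 0 := by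
    refine le_antisymm (h ▸ le_iInf fun n => ?_) zero_le
    have := infinitePi_drivenPath_avoid_le p D s n []
    simp only [chainPathProb, one_mul, List.getLast_singleton] at this
    refine (measure_mono fun ξ hξ => ?_).trans this
    exact ⟨⟨rfl, fun i hi => absurd hi (by simp)⟩, hξ⟩
  change 1 ≤ ν {ξ | (∃ i, drivenPath ξ s i ∉ D) ∧ drivenPath ξ s 0 = s}
  calc (1 : ℝ≥0∞) = ν Set.univ := measure_univ.symm
    _ ≤ ν ({ξ | (∃ i, drivenPath ξ s i ∉ D) ∧ drivenPath ξ s 0 = s} ∪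
          {ξ | ∀ i, drivenPath ξ s i ∈ D}) := measure_mono fun ξ _ => by
        by_cases hξ : ∀ i, drivenPath ξ s i ∈ D
        · exact Or.inr hξ
        · exact Or.inl ⟨not_forall.1 hξ, rfl⟩
    _ ≤ _ := (measure_union_le _ _).trans (by rw [hzero, add_zero])

theorem avoidProb_succ_le {k : S → S → ℝ≥0∞} (hk : ∀ s, ∑' t, k s t = 1) (D : Set S) (n : ℕ)
    (s : S) : avoidProb k D (n + 1) s ≤ avoidProb k D n s := by
  induction n generalizing s with
  | zero =>
    simp only [avoidProb, mul_one, hk]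
    split_ifs <;> simp
  | succ n ih =>
    rw [avoidProb, avoidProb]
    split_ifs
    · exact ENNReal.tsum_le_tsum fun t => mul_le_mul_right (ih t) _
    · rfl

/-- The probability of never leaving `D` is subharmonic on `D`. -/
theorem iInf_avoidProb_le_tsum {k : S → S → ℝ≥0∞} (hk : ∀ s, ∑' t, k s t = 1) (D : Set S)
    {s : S} (hs : s ∈ D) :
    ⨅ n, avoidProb k D n s ≤ ∑' t, k s t * ⨅ n, avoidProb k D n t := by
  let _ : MeasurableSpace S := ⊤
  have hfin : ∀ t, k s t ≠ ∞ := fun t =>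
    ne_top_of_le_ne_top ENNReal.one_ne_top (hk s ▸ ENNReal.le_tsum t)
  have hanti : Antitone fun n t => k s t * avoidProb k D n t :=
    antitone_nat_of_succ_le fun n t => mul_le_mul_right (avoidProb_succ_le hk D n t) _
  have hlim := lintegral_iInf (μ := Measure.count) (fun n => measurable_from_top) hanti
    (by simp [avoidProb, lintegral_count, hk])
  simp only [lintegral_count] at hlim
  have : ∀ t, k s t * ⨅ n, avoidProb k D n t = ⨅ n, k s t * avoidProb k D n t := fun t =>
    ENNReal.mul_iInf fun h => absurd h (hfin t)
  simp_rw [this, hlim]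
  refine le_iInf fun n => iInf_le_of_le (n + 1) ?_
  rw [avoidProb, if_pos hs]

/-- A bounded subharmonic function vanishes if its zero set is reachable from every state and the
chain has a Lyapunov function `V` with finite sublevel sets and geometric drift. -/
theorem eq_zero_of_le_tsum {P : S → S → ℝ≥0∞} (hP : ∀ s, ∑' t, P s t = 1) {V : S → ℕ}
    (hV : ∀ n, {s | V s ≤ n}.Finite) {r : ℝ} (hr0 : 0 ≤ r) (hr : r < 1)
    (hdrift : ∀ s, ∑' t, P s t * V t ≤ ENNReal.ofReal r * (V s + 1)) {h : S → ℝ≥0∞}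
    (hle : ∀ s, h s ≤ 1) (hsub : ∀ s, h s ≤ ∑' t, P s t * h t)
    (hreach : ∀ s, ∃ t, Relation.ReflTransGen (fun a b => P a b ≠ 0) s t ∧ h t = 0) (s : S) :
    h s = 0 := by
  have hfin : ∀ s, h s ≠ ∞ := fun s => ne_top_of_le_ne_top ENNReal.one_ne_top (hle s)
  have hle' : ∀ s, (h s).toReal ≤ 1 := fun s => by
    simpa using ENNReal.toReal_mono ENNReal.one_ne_top (hle s)
  have hmax : ∃ a, ∀ t, h t ≤ h a := by
    obtain ⟨B, hB⟩ := exists_nat_gt (r / (1 - r))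
    obtain ⟨a, -, ha⟩ := Set.exists_max_image _ (fun t => (h t).toReal) (hV (max B (V s)))
      ⟨s, show V s ≤ _ from le_max_right _ _⟩
    refine ⟨a, fun b => ?_⟩
    by_contra! hab
    have hab' : (h a).toReal < (h b).toReal := (ENNReal.toReal_lt_toReal (hfin a) (hfin b)).2 hab
    let η : ℝ := ((h b).toReal - (h a).toReal) / (V b + 1)
    have hVb : (0 : ℝ) < V b + 1 := by positivity
    have hη : 0 < η := div_pos (by linarith) hVb
    have hηb : (h a).toReal < (h b).toReal - η * V b := by
      have : η * (V b + 1) = (h b).toReal - (h a).toReal := div_mul_cancel₀ _ hVb.ne'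
      linarith
    obtain ⟨K, hK⟩ := exists_nat_gt (1 / η)
    obtain ⟨c, -, hc⟩ := Set.exists_max_image _ (fun t => (h t).toReal - η * V t)
      (hV (max K (V b))) ⟨b, show V b ≤ _ from le_max_right _ _⟩
    have hbc := hc b (show V b ≤ _ from le_max_right _ _)
    have hglob : ∀ t, (h t).toReal - η * V t ≤ (h c).toReal - η * V c := fun t => by
      by_cases ht : V t ≤ max K (V b)
      · exact hc t ht
      · have h1 : (K : ℝ) ≤ V t := by exact_mod_cast (le_max_left _ _).trans (not_le.1 ht).le
        rw [div_lt_iff₀ hη] at hK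
        have := hle' t
        have := (h a).toReal_nonneg
        nlinarith
    have hcB : (B : ℝ) < V c := by
      by_contra! hcB
      have := ha c (show V c ≤ max B (V s) from (by exact_mod_cast hcB : V c ≤ B).trans
        (le_max_left _ _))
      have : 0 ≤ η * V c := by positivity
      linarith
    have hg : 0 ≤ (h c).toReal - η * V c := by
      have := (h a).toReal_nonneg
      linarith
    have hbound : h c ≤ ENNReal.ofReal ((h c).toReal - η * V c + η * (r * (V c + 1))) := by
      calc h c ≤ ∑' t, P c t * h t := hsub c
        _ ≤ ∑' t, (P c t * ENNReal.ofReal ((h c).toReal - η * V c) +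
              ENNReal.ofReal η * (P c t * V t)) := by
            refine ENNReal.tsum_le_tsum fun t => ?_
            rw [← mul_left_comm, ← mul_add]
            refine mul_le_mul_right ?_ _
            rw [← ENNReal.ofReal_toReal (hfin t), ← ENNReal.ofReal_natCast,
              ← ENNReal.ofReal_mul hη.le, ← ENNReal.ofReal_add hg (by positivity)]
            exact ENNReal.ofReal_le_ofReal (by linarith [hglob t])
        _ ≤ ENNReal.ofReal ((h c).toReal - η * V c) +
              ENNReal.ofReal η * (ENNReal.ofReal r * (V c + 1)) := by
            rw [ENNReal.tsum_add, ENNReal.tsum_mul_right, ENNReal.tsum_mul_left, hP, one_mul]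
            exact add_le_add_right (mul_le_mul_right (hdrift c) _) _
        _ = _ := by
            rw [ENNReal.ofReal_add hg (by positivity), ENNReal.ofReal_mul hη.le,
              ENNReal.ofReal_mul hr0, ENNReal.ofReal_add (by positivity) zero_le_one,
              ENNReal.ofReal_natCast, ENNReal.ofReal_one]
    have hreal := ENNReal.toReal_mono ENNReal.ofReal_ne_top hbound
    rw [ENNReal.toReal_ofReal (by positivity)] at hreal
    have hVc : (V c : ℝ) ≤ r * (V c + 1) := le_of_mul_le_mul_left (by linarith) hη
    rw [div_lt_iff₀ (by linarith)] at hB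
    nlinarith
  obtain ⟨a, ha⟩ := hmax
  have hconst : ∀ z, Relation.ReflTransGen (fun a b => P a b ≠ 0) a z → h z = h a := by
    intro z haz
    induction haz with
    | refl => rfl
    | @tail b c _ hbc ih =>
      by_contra hne
      have hbc' : P b c ≠ ∞ := ne_top_of_le_ne_top ENNReal.one_ne_top (hP b ▸ ENNReal.le_tsum c)
      have hfinite : ∑' t, P b t * h t ≠ ∞ := by
        refine ne_top_of_le_ne_top ENNReal.one_ne_top (hP b ▸ ENNReal.tsum_le_tsum fun t => ?_)
        exact mul_le_of_le_one_right zero_le (hle t)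
      have hlt : ∑' t, P b t * h t < ∑' t, P b t * h a :=
        ENNReal.tsum_lt_tsum hfinite (fun t => mul_le_mul_right (ha t) _)
          ((ENNReal.mul_lt_mul_iff_right hbc hbc').2 (lt_of_le_of_ne (ha c) hne))
      rw [ENNReal.tsum_mul_right, hP, one_mul, ← ih] at hlt
      exact (hsub b).not_gt hlt
  obtain ⟨z, haz, hz⟩ := hreach a
  exact le_antisymm ((ha s).trans (hconst z haz ▸ hz.le)) zero_le

end ChainAvoidance

/-! ## Message losses -/

section MessageLoss

set_option linter.unusedSectionVars false

/-- Weight of losing messages of `v` so as to obtain `w` on a single channel, where each message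
is lost with weight `t` and kept with weight `r`. -/
noncomputable def lossWeight (t r : ℝ≥0∞) (v w : List M) : ℝ≥0∞ :=
  t ^ (v.length - w.length) * r ^ w.length * countEmb v w

theorem countEmb_nil_right (v : List M) : countEmb v [] = 1 := by
  cases v <;> rfl

theorem countEmb_eq_zero_of_length_lt {v w : List M} (h : v.length < w.length) :
    countEmb v w = 0 := by
  induction v generalizing w with
  | nil => cases w with
    | nil => simp at h
    | cons b w => rfl
  | cons a v ih => cases w with
    | nil => simp at h
    | cons b w =>
      simp only [List.length_cons, Nat.add_lt_add_iff_right] at h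
      rw [countEmb, ih h, ih (w := b :: w) (h.trans (by simp))]
      simp

theorem countEmb_pos_of_sublist {v w : List M} (h : List.Sublist w v) : 0 < countEmb v w := by
  induction h with
  | slnil => simp [countEmb]
  | @cons w v a _ ih => cases w with
    | nil => simp [countEmb]
    | cons b w => rw [countEmb]; omega
  | cons_cons a _ ih => rw [countEmb, if_pos rfl]; omega

theorem lossWeight_cons_cons (t r : ℝ≥0∞) (a b : M) (v w : List M) :
    lossWeight t r (a :: v) (b :: w) =
      (if a = b then r * lossWeight t r v w else 0) + t * lossWeight t r v (b :: w) := by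
  simp only [lossWeight, countEmb, List.length_cons, Nat.add_sub_add_right, Nat.cast_add, mul_add]
  congr 1
  · split_ifs <;> simp [pow_succ]; ring
  · rcases lt_or_ge v.length (w.length + 1) with h | h
    · rw [countEmb_eq_zero_of_length_lt (by simpa using h)]; simp
    · rw [show v.length - w.length = v.length - (w.length + 1) + 1 by omega, pow_succ]; ring

theorem tsum_lossWeight_cons (t r : ℝ≥0∞) (a : M) (v : List M) (f : List M → ℝ≥0∞) :
    ∑' w, lossWeight t r (a :: v) w * f w =
      t * ∑' w, lossWeight t r v w * f w + r * ∑' w, lossWeight t r v w * f (a :: w) := by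
  have hsplit : ∀ w, lossWeight t r (a :: v) w * f w = t * (lossWeight t r v w * f w) +
      (if w.head? = some a then r * lossWeight t r v w.tail * f w else 0) := by
    rintro (_ | ⟨b, w⟩)
    · simp [lossWeight, countEmb_nil_right, pow_succ]; ring
    · rw [lossWeight_cons_cons, add_mul, add_comm, mul_assoc]
      by_cases h : a = b
      · simp [h]
      · simp [h, Ne.symm h]
  simp_rw [hsplit, ENNReal.tsum_add, ENNReal.tsum_mul_left]
  congr 1
  rw [← ENNReal.tsum_mul_left, ← Function.Injective.tsum_eq (g := fun w => a :: w)
    (List.cons_injective)]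
  · simp [mul_assoc]
  · rintro (_ | ⟨b, w⟩) hw
    · simp at hw
    · simp only [Function.mem_support, List.head?_cons, Option.some.injEq, ne_eq, ite_eq_right_iff,
        Classical.not_imp] at hw
      exact ⟨w, by rw [hw.1]⟩

theorem tsum_lossWeight {t r : ℝ≥0∞} (h : t + r = 1) (v : List M) :
    ∑' w, lossWeight t r v w = 1 := by
  induction v with
  | nil =>
    rw [tsum_eq_single [] fun w hw => ?_]
    · simp [lossWeight, countEmb]
    · simp [lossWeight, countEmb_eq_zero_of_length_lt (v := []) (List.length_pos_iff.2 hw)]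
  | cons a v ih => simpa [ih, h] using tsum_lossWeight_cons t r a v fun _ => 1

theorem tsum_lossWeight_mul_length {t r : ℝ≥0∞} (h : t + r = 1) (v : List M) :
    ∑' w, lossWeight t r v w * (w.length : ℝ≥0∞) = r * v.length := by
  induction v with
  | nil =>
    rw [tsum_eq_single [] fun w hw => ?_]
    · simp
    · simp [lossWeight, countEmb_eq_zero_of_length_lt (v := []) (List.length_pos_iff.2 hw)]
  | cons a v ih =>
    rw [tsum_lossWeight_cons t r a v fun w => w.length]
    simp only [List.length_cons, Nat.cast_add, Nat.cast_one, mul_add, ENNReal.tsum_add, mul_one, ih,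
      tsum_lossWeight h]
    rw [← add_assoc, ← add_mul, h, one_mul]

theorem finite_support_lossWeight [Finite M] (t r : ℝ≥0∞) (v : List M) :
    (Function.support (lossWeight t r v)).Finite := by
  refine (List.finite_length_le M v.length).subset fun w hw => ?_
  by_contra h
  exact hw (by simp [lossWeight, countEmb_eq_zero_of_length_lt (not_le.1 h)])

theorem tsum_pi_prod_of_finite_support {ι α : Type} [Fintype ι] [DecidableEq ι]
    (g : ι → α → ℝ≥0∞) (hg : ∀ i, (Function.support (g i)).Finite) :
    ∑' f : ι → α, ∏ i, g i (f i) = ∏ i, ∑' a, g i a := by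
  have hz : ∀ i, ∀ a ∉ (hg i).toFinset, g i a = 0 := fun i a ha => by simpa using ha
  rw [tsum_eq_sum (s := Fintype.piFinset fun i => (hg i).toFinset) fun f hf => ?_]
  · rw [Finset.prod_congr rfl fun i _ => tsum_eq_sum (hz i), Finset.prod_univ_sum]
  · rw [Fintype.mem_piFinset, not_forall] at hf
    obtain ⟨i, hi⟩ := hf
    exact Finset.prod_eq_zero (Finset.mem_univ i) (hz i _ hi)

theorem plost_eq_prod {τ : ℝ} (h0 : 0 ≤ τ) (h1 : τ ≤ 1) (v v' : Chans C M) :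
    plost τ v v' =
      ∏ c, lossWeight (ENNReal.ofReal τ) (ENNReal.ofReal (1 - τ)) (v c) (v' c) := by
  have h1' : 0 ≤ 1 - τ := by linarith
  simp only [plost, lossWeight, Finset.prod_mul_distrib, Finset.prod_pow_eq_pow_sum]
  rw [ENNReal.ofReal_mul (by positivity), ENNReal.ofReal_mul (by positivity),
    ENNReal.ofReal_pow h0, ENNReal.ofReal_pow h1', ENNReal.ofReal_natCast, Nat.cast_prod]
  by_cases h : ∀ c, (v' c).length ≤ (v c).length
  · rw [chansSize, chansSize, Finset.sum_tsub_distrib _ fun c _ => h c]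
  · rw [not_forall] at h
    obtain ⟨c, hc⟩ := h
    rw [Finset.prod_eq_zero (Finset.mem_univ c)
      (by rw [countEmb_eq_zero_of_length_lt (not_le.1 hc), Nat.cast_zero]), mul_zero, mul_zero]

theorem ofReal_add_ofReal_one_sub {τ : ℝ} (h0 : 0 ≤ τ) (h1 : τ ≤ 1) :
    ENNReal.ofReal τ + ENNReal.ofReal (1 - τ) = 1 := by
  rw [← ENNReal.ofReal_add h0 (by linarith)]
  simp

theorem tsum_plost [Finite M] {τ : ℝ} (h0 : 0 ≤ τ) (h1 : τ ≤ 1) (v : Chans C M) :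
    ∑' v', plost τ v v' = 1 := by
  simp_rw [plost_eq_prod h0 h1]
  rw [tsum_pi_prod_of_finite_support _ fun c => finite_support_lossWeight _ _ _]
  simp [tsum_lossWeight (ofReal_add_ofReal_one_sub h0 h1)]

theorem tsum_plost_mul_chansSize [Finite M] {τ : ℝ} (h0 : 0 ≤ τ) (h1 : τ ≤ 1) (v : Chans C M) :
    ∑' v', plost τ v v' * (chansSize v' : ℝ≥0∞) = ENNReal.ofReal (1 - τ) * chansSize v := by
  have hadd := ofReal_add_ofReal_one_sub h0 h1
  simp only [chansSize, Nat.cast_sum, Finset.mul_sum]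
  rw [Summable.tsum_finsetSum fun _ _ => ENNReal.summable]
  refine Finset.sum_congr rfl fun c _ => ?_
  have hprod : ∀ v' : Chans C M, plost τ v v' * ((v' c).length : ℝ≥0∞) =
      ∏ d, (lossWeight (ENNReal.ofReal τ) (ENNReal.ofReal (1 - τ)) (v d) (v' d) *
        if d = c then ((v' d).length : ℝ≥0∞) else 1) := fun v' => by
    rw [plost_eq_prod h0 h1, Finset.prod_mul_distrib, Finset.prod_ite_eq' Finset.univ c]
    simp
  simp_rw [hprod]
  rw [tsum_pi_prod_of_finite_support (fun d w =>
      lossWeight (ENNReal.ofReal τ) (ENNReal.ofReal (1 - τ)) (v d) w *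
        if d = c then (w.length : ℝ≥0∞) else 1) fun d =>
      (finite_support_lossWeight _ _ (v d)).subset fun w hw => left_ne_zero_of_mul hw,
    Finset.prod_eq_single c]
  · simp [tsum_lossWeight_mul_length hadd]
  · intro d _ hd
    simp [hd, tsum_lossWeight hadd]
  · simp

theorem plost_ne_zero_of_sublist {τ : ℝ} (h0 : 0 < τ) (h1 : τ < 1) {v v' : Chans C M}
    (h : ∀ c, List.Sublist (v' c) (v c)) : plost τ v v' ≠ 0 := by
  have : 0 < 1 - τ := by linarith
  have hc : 0 < ∏ c, countEmb (v c) (v' c) :=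
    Finset.prod_pos fun c _ => countEmb_pos_of_sublist (h c)
  rw [plost, ne_eq, ENNReal.ofReal_eq_zero, not_le]
  positivity

theorem chansSize_applyOp_le (op : LcsOp C M) (w : Chans C M) :
    chansSize (applyOp op w) ≤ chansSize w + 1 := by
  have hupd : ∀ (c : C) (l : List M), l.length ≤ (w c).length + 1 →
      chansSize (Function.update w c l) ≤ chansSize w + 1 := by
    intro c l hl
    rw [chansSize, chansSize, ← Finset.add_sum_erase _ _ (Finset.mem_univ c),
      ← Finset.add_sum_erase _ (fun d => (w d).length) (Finset.mem_univ c),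
      Finset.sum_congr rfl fun d hd => by
        rw [Function.update_of_ne (Finset.ne_of_mem_erase hd)], Function.update_self]
    omega
  cases op with
  | send c m => exact hupd c _ (by simp)
  | recv c m => exact hupd c _ (by simp; omega)
  | internal => exact Nat.le_succ _

theorem finite_chansSize_le [Finite M] (n : ℕ) : {w : Chans C M | chansSize w ≤ n}.Finite := by
  refine (Set.Finite.pi' fun _ : C => List.finite_length_le M n).subset fun w hw c => ?_
  exact (Finset.single_le_sum (f := fun c => (w c).length) (fun _ _ => zero_le)
    (Finset.mem_univ c)).trans hw

theorem enabledOp_of_not_isRecv {op : LcsOp C M} (h : ¬ op.IsRecv) (w : Chans C M) :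
    enabledOp op w := by
  cases op with
  | recv c m => exact absurd trivial h
  | _ => trivial

theorem applyOp_sublist_applyOp_of_not_isRecv {op : LcsOp C M} (h : ¬ op.IsRecv)
    {v w : Chans C M} (hvw : ∀ c, List.Sublist (v c) (w c)) (c : C) :
    List.Sublist (applyOp op v c) (applyOp op w c) := by
  cases op with
  | send d m =>
    by_cases hc : c = d
    · subst hc; simpa [applyOp] using hvw c
    · simpa [applyOp, hc] using hvw c
  | recv d m => exact absurd trivial h
  | internal => exact hvw c

end MessageLoss

/-! ## Step probabilities -/

section StepProbabilities

theorem NPLCS.tsum_stepProb_mul (N : NPLCS Q C M) {s : Conf Q C M} {δ : LcsRule Q C M}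
    (hδ : δ ∈ N.L.rules) (he : δ.EnabledIn s) (f : Conf Q C M → ℝ≥0∞) :
    ∑' t, N.stepProb s δ t * f t =
      ∑' w, plost N.τ (applyOp δ.op s.2) w * f (δ.dst, w) := by
  rw [← Function.Injective.tsum_eq (g := fun w => (δ.dst, w)) (Prod.mk_right_injective _)]
  · simp [NPLCS.stepProb, hδ, he]
  · rintro ⟨q, w⟩ hw
    have : q = δ.dst := by
      by_contra h
      simp [NPLCS.stepProb, h] at hw
    exact ⟨w, by rw [this]⟩

theorem NPLCS.tsum_stepProb [Finite M] (N : NPLCS Q C M) {s : Conf Q C M} {δ : LcsRule Q C M}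
    (hδ : δ ∈ N.L.rules) (he : δ.EnabledIn s) : ∑' t, N.stepProb s δ t = 1 := by
  simpa [tsum_plost N.τ_pos.le N.τ_lt_one.le] using N.tsum_stepProb_mul hδ he fun _ => 1

theorem NPLCS.tsum_stepProb_mul_chansSize_le [Finite M] (N : NPLCS Q C M) {s : Conf Q C M}
    {δ : LcsRule Q C M} (hδ : δ ∈ N.L.rules) (he : δ.EnabledIn s) :
    ∑' t, N.stepProb s δ t * (chansSize t.2 : ℝ≥0∞) ≤
      ENNReal.ofReal (1 - N.τ) * (chansSize s.2 + 1) := by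
  rw [N.tsum_stepProb_mul hδ he fun t => chansSize t.2,
    tsum_plost_mul_chansSize N.τ_pos.le N.τ_lt_one.le]
  gcongr
  exact_mod_cast chansSize_applyOp_le δ.op s.2

theorem LCS.StepVia.stepProb_ne_zero {N : NPLCS Q C M} {s t : Conf Q C M} {δ : LcsRule Q C M}
    (h : N.L.StepVia s δ t) : N.stepProb s δ t ≠ 0 := by
  rw [NPLCS.stepProb, if_pos ⟨h.1, h.2.1, h.2.2.1⟩]
  exact plost_ne_zero_of_sublist N.τ_pos N.τ_lt_one h.2.2.2

theorem NPLCS.eq_dst_of_stepProb_ne_zero {N : NPLCS Q C M} {s t : Conf Q C M}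
    {δ : LcsRule Q C M} (h : N.stepProb s δ t ≠ 0) : t.1 = δ.dst := by
  by_contra hne
  exact h (if_neg fun h' => hne h'.2.2)

theorem NPLCS.iInf_avoidProb_eq_zero [Finite Q] [Finite M] (N : NPLCS Q C M) (A : Set Q)
    {ch : Conf Q C M → LcsRule Q C M} (hrule : ∀ s, ch s ∈ N.L.rules)
    (hen : ∀ s, (ch s).EnabledIn s) {Z : Set (Conf Q C M)}
    (hclosed : ∀ s ∈ Z, s.1 ∉ A → ∀ t, N.stepProb s (ch s) t ≠ 0 → t ∈ Z)
    (hreach : ∀ s ∈ Z, ∃ t,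
      Relation.ReflTransGen (fun a b => N.stepProb a (ch a) b ≠ 0) s t ∧ t.1 ∈ A)
    {s : Conf Q C M} (hs : s ∈ Z) :
    ⨅ n, avoidProb (fun a b => N.stepProb a (ch a) b) {a | a.1 ∉ A} n s = 0 := by
  have hP : ∀ s, ∑' t, N.stepProb s (ch s) t = 1 := fun s => N.tsum_stepProb (hrule s) (hen s)
  have hA : ∀ t : Conf Q C M, t.1 ∈ A →
      ⨅ n, avoidProb (fun a b => N.stepProb a (ch a) b) {a | a.1 ∉ A} n t = 0 := fun t ht =>
    le_antisymm (iInf_le_of_le 1 (by simp [avoidProb, ht])) zero_le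
  have hfinV : ∀ n, {s : Conf Q C M | chansSize s.2 ≤ n}.Finite := fun n =>
    (Set.finite_univ.prod (finite_chansSize_le n)).subset fun s hs => ⟨trivial, hs⟩
  have key := eq_zero_of_le_tsum hP hfinV (r := 1 - N.τ) (by linarith [N.τ_lt_one])
    (by linarith [N.τ_pos]) (fun s => N.tsum_stepProb_mul_chansSize_le (hrule s) (hen s))
    (h := fun s => if s ∈ Z then
      ⨅ n, avoidProb (fun a b => N.stepProb a (ch a) b) {a | a.1 ∉ A} n s else 0)
    (fun s => ?_) (fun s => ?_) (fun s => ?_) s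
  · simpa [hs] using key
  · split_ifs
    · exact iInf_le_of_le 0 le_rfl
    · exact zero_le_one
  · by_cases hsZ : s ∈ Z
    · by_cases hsA : s.1 ∈ A
      · simp [hA s hsA]
      · rw [if_pos hsZ]
        refine (iInf_avoidProb_le_tsum hP _ hsA).trans (ENNReal.tsum_le_tsum fun t => ?_)
        by_cases ht : N.stepProb s (ch s) t = 0
        · simp [ht]
        · rw [if_pos (hclosed s hsZ hsA t ht)]
    · simp [hsZ]
  · by_cases hsZ : s ∈ Z
    · obtain ⟨t, hst, ht⟩ := hreach s hsZ
      exact ⟨t, hst, by simp [hA t ht]⟩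
    · exact ⟨s, .refl, if_neg hsZ⟩

end StepProbabilities

/-! ## Histories -/

section Histories

theorem Scheduler.tsum_kernel_mul (U : Scheduler N) (a : List (Conf Q C M) × Conf Q C M)
    (f : List (Conf Q C M) × Conf Q C M → ℝ≥0∞) :
    ∑' b, U.kernel a b * f b =
      ∑' t, N.stepProb a.2 (U.choose a.1 a.2) t * f (a.1 ++ [a.2], t) := by
  rw [← Function.Injective.tsum_eq (g := fun t => (a.1 ++ [a.2], t)) (Prod.mk_right_injective _)]
  · simp [Scheduler.kernel]
  · rintro ⟨l, t⟩ hw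
    have : l = a.1 ++ [a.2] := by
      by_contra h
      simp [Scheduler.kernel, h] at hw
    exact ⟨t, by rw [this]⟩

theorem Scheduler.tsum_kernel [Finite M] (U : Scheduler N)
    (a : List (Conf Q C M) × Conf Q C M) : ∑' b, U.kernel a b = 1 := by
  simpa [N.tsum_stepProb (U.choose_mem _ _) (U.choose_enabled _ _)] using
    U.tsum_kernel_mul a fun _ => 1

theorem Scheduler.avoidProb_kernel (U : Scheduler N) {ch : Conf Q C M → LcsRule Q C M}
    (hU : ∀ h s, U.choose h s = ch s) (D : Set (Conf Q C M)) (n : ℕ)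
    (a : List (Conf Q C M) × Conf Q C M) :
    avoidProb U.kernel {b | b.2 ∈ D} n a =
      avoidProb (fun s t => N.stepProb s (ch s) t) D n a.2 := by
  induction n generalizing a with
  | zero => rfl
  | succ n ih => simp only [avoidProb, U.tsum_kernel_mul, ih, hU, Set.mem_ofPred_eq]

theorem Scheduler.Pr_evEventually_eq_one [Finite Q] [Finite M] (U : Scheduler N)
    {ch : Conf Q C M → LcsRule Q C M} (hU : ∀ h s, U.choose h s = ch s) (A : Set Q)
    {s : Conf Q C M}
    (hs : ⨅ n, avoidProb (fun a b => N.stepProb a (ch a) b) {a | a.1 ∉ A} n s = 0) :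
    U.Pr s (evEventually (inLoc A)) = 1 := by
  have h := chainPr_eq_one_of_iInf_avoidProb (s := ([], s)) (D := {b | b.2 ∈ {a | a.1 ∉ A}})
    U.tsum_kernel (by simpa only [U.avoidProb_kernel hU] using hs)
  simpa [Scheduler.Pr, evEventually, inLoc] using h

end Histories

/-! ## Promising locations -/

section Promising

set_option linter.unusedSectionVars false

/-- A location of `A` can be reached from `s` in `n` steps, visiting only locations of `X` before
the last step. -/
def LCS.ReachesIn (L : LCS Q C M) (X A : Set Q) : ℕ → Conf Q C M → Prop
  | 0, s => s.1 ∈ A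
  | n + 1, s => s.1 ∈ X ∧ ∃ t, L.Step s t ∧ L.ReachesIn X A n t

theorem LCS.ReachesIn.mem {L : LCS Q C M} {X A : Set Q} {n : ℕ} {s : Conf Q C M}
    (h : L.ReachesIn X A n s) : s.1 ∈ A ∨ s.1 ∈ X := by
  cases n with
  | zero => exact Or.inl h
  | succ n => exact Or.inr h.1

theorem LCS.ReachWithin.exists_reachesIn {L : LCS Q C M} {X A : Set Q} {s t : Conf Q C M}
    (h : L.ReachWithin X s t) (ht : t.1 ∈ A) : ∃ n, L.ReachesIn X A n s := by
  induction h using Relation.ReflTransGen.head_induction_on with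
  | refl => exact ⟨0, ht⟩
  | head hab _ ih =>
    obtain ⟨n, hn⟩ := ih
    exact ⟨n + 1, hab.2, _, hab.1, hn⟩

theorem LCS.isPromisingFor_prom (L : LCS Q C M) (A : Set Q) :
    L.IsPromisingFor A (L.Prom A) := by
  rintro x ⟨X, hX, hx⟩
  obtain ⟨t, hxt, ht⟩ := hX x hx
  have hle : (fun a b => L.Step a b ∧ a.1 ∈ X) ≤ fun a b => L.Step a b ∧ a.1 ∈ L.Prom A :=
    fun a b h => ⟨h.1, X, hX, h.2⟩
  exact ⟨t, Relation.ReflTransGen.mono hle _ _ hxt, ht⟩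

theorem LCS.step_of_step_eps {L : LCS Q C M} {q : Q} {t : Conf Q C M}
    (h : L.Step (q, eps C M) t) (w : Chans C M) : L.Step (q, w) t := by
  obtain ⟨δ, hδ, ⟨hsrc, hop⟩, hdst, hsub⟩ := h
  have hrecv : ¬ δ.op.IsRecv := by
    intro h
    cases hδop : δ.op with
    | recv c m =>
      rw [hδop] at hop
      obtain ⟨v, hv⟩ := hop
      simp [eps] at hv
    | _ => rw [hδop] at h; exact h
  exact ⟨δ, hδ, ⟨hsrc, enabledOp_of_not_isRecv hrecv w⟩, hdst, fun c => (hsub c).trans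
    (applyOp_sublist_applyOp_of_not_isRecv hrecv (fun c => List.nil_sublist _) c)⟩

theorem LCS.IsPromisingFor.exists_reachesIn {L : LCS Q C M} {X A : Set Q}
    (hX : L.IsPromisingFor A X) {s : Conf Q C M} (hs : s.1 ∈ A ∨ s.1 ∈ X) :
    ∃ n, L.ReachesIn X A n s := by
  by_cases hsA : s.1 ∈ A
  · exact ⟨0, hsA⟩
  · have hsX := hs.resolve_left hsA
    obtain ⟨t, hst, ht⟩ := hX _ hsX
    rcases Relation.ReflTransGen.cases_head hst with rfl | ⟨y, hy, hyt⟩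
    · exact absurd ht hsA
    · obtain ⟨n, hn⟩ := LCS.ReachWithin.exists_reachesIn hyt ht
      exact ⟨n + 1, hsX, y, LCS.step_of_step_eps hy.1 s.2, hn⟩

theorem LCS.exists_enabled_rule (L : LCS Q C M) (s : Conf Q C M) :
    ∃ δ ∈ L.rules, δ.EnabledIn s := by
  obtain ⟨δ, hδ, hsrc, hrecv⟩ := L.noDeadlock s.1
  exact ⟨δ, hδ, hsrc, enabledOp_of_not_isRecv hrecv s.2⟩

/-- An enabled rule that starts a shortest path to `A` within `X`, if there is one. -/
theorem LCS.exists_shortest_rule (L : LCS Q C M) (X A : Set Q) (s : Conf Q C M) :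
    ∃ δ ∈ L.rules, δ.EnabledIn s ∧ (s.1 ∉ A → ∀ n, L.ReachesIn X A n s →
      ∃ t, ∃ m < n, L.StepVia s δ t ∧ L.ReachesIn X A m t) := by
  by_cases h : s.1 ∉ A ∧ ∃ n, L.ReachesIn X A n s
  · obtain ⟨hA, h⟩ := h
    have hfind := Nat.find_spec h
    cases hk : Nat.find h with
    | zero =>
      rw [hk] at hfind
      exact absurd hfind hA
    | succ k =>
      rw [hk] at hfind
      obtain ⟨-, t, ⟨δ, hδ⟩, ht⟩ := hfind
      exact ⟨δ, hδ.1, hδ.2.1, fun _ n hn =>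
        ⟨t, k, by have := Nat.find_min' h hn; omega, hδ, ht⟩⟩
  · obtain ⟨δ, hδ, he⟩ := L.exists_enabled_rule s
    exact ⟨δ, hδ, he, fun hA n hn => absurd ⟨hA, n, hn⟩ h⟩

end Promising

/-- There is a memoryless scheduler under which, from any `x ∈ Prom(A)` with
any channel contents, almost surely a location of `A` is eventually
visited. -/
theorem statement4 {Q C M : Type} [Fintype Q] [Fintype C] [DecidableEq C]
    [Fintype M] [DecidableEq M] (N : NPLCS Q C M) (A : Set Q) :
    ∃ U : Scheduler N, U.Memoryless ∧
      ∀ x ∈ N.L.Prom A, ∀ w : Chans C M,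
        U.Pr (x, w) (evEventually (inLoc A)) = 1 := by
  choose ch hrule hen hch using N.L.exists_shortest_rule (N.L.Prom A) A
  let U : Scheduler N := ⟨fun _ s => ch s, fun _ s => hrule s, fun _ s => hen s⟩
  refine ⟨U, fun _ _ _ => rfl, fun x hx w => U.Pr_evEventually_eq_one (fun _ _ => rfl) A ?_⟩
  have hprom := N.L.isPromisingFor_prom A
  refine N.iInf_avoidProb_eq_zero A hrule hen (Z := {s | ∃ n, N.L.ReachesIn (N.L.Prom A) A n s})
    ?_ ?_ (hprom.exists_reachesIn (Or.inr hx))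
  · rintro s ⟨n, hn⟩ hsA t ht
    obtain ⟨t', m, -, hstep, hm⟩ := hch s hsA n hn
    refine hprom.exists_reachesIn ?_
    rw [NPLCS.eq_dst_of_stepProb_ne_zero ht, ← hstep.2.2.1]
    exact hm.mem
  · rintro s ⟨n, hn⟩
    induction n using Nat.strong_induction_on generalizing s with
    | _ n ih =>
      by_cases hsA : s.1 ∈ A
      · exact ⟨s, .refl, hsA⟩
      · obtain ⟨t, m, hm, hstep, ht⟩ := hch s hsA n hn
        obtain ⟨z, htz, hz⟩ := ih m hm t ht
        exact ⟨z, .head hstep.stepProb_ne_zero htz, hz⟩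

end NPLCSmodel
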